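/- arXiv:2602.16923 — 11 statements merged into one kernel-verified Lean document; each statement's English description precedes it below -/
import Mathlib

section
/- For every real τ > 0 and every real y with exp(−4τ) ≤ y ≤ exp(4τ), one has y − 1 − log y ≥ ((4τ + exp(−4τ) − 1) / (16·τ²)) · (log y)². -/
lemma aux_k (t : ℝ) (ht : 0 ≤ t) : 2 - t - Real.exp (-t) * (t + 2) ≤ 0 := by
  have hd : ∀ x : ℝ, HasDerivAt (fun t : ℝ => 2 - t - Real.exp (-t) * (t + 2))
      (-1 + Real.exp (-x) * (x + 1)) x := by
    intro x
    have h1 : HasDerivAt (fun t : ℝ => Real.exp (-t)) (Real.exp (-x) * (-1)) x :=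
      (hasDerivAt_id x).neg.exp
    have h2 := ((hasDerivAt_id x).const_sub 2).sub (h1.mul ((hasDerivAt_id x).add_const 2))
    refine h2.congr_deriv ?_
    simp only [id]
    ring
  have ha : AntitoneOn (fun t : ℝ => 2 - t - Real.exp (-t) * (t + 2)) (Set.Ici 0) := by
    apply antitoneOn_of_deriv_nonpos (convex_Ici 0)
    · exact fun x _ => (hd x).continuousAt.continuousWithinAt
    · exact fun x _ => (hd x).differentiableAt.differentiableWithinAt
    · intro x _
      rw [(hd x).deriv]
      have h := Real.add_one_le_exp x
      have h3 : Real.exp (-x) * Real.exp x = 1 := by rw [← Real.exp_add]; simp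
      nlinarith [Real.exp_pos (-x)]
  have := ha (Set.mem_Ici.2 le_rfl) (Set.mem_Ici.2 ht) ht
  simpa using this

lemma aux_phi : AntitoneOn (fun t : ℝ => (t + Real.exp (-t) - 1) / t ^ 2) (Set.Ioi 0) := by
  have hd : ∀ x : ℝ, 0 < x → HasDerivAt (fun t : ℝ => (t + Real.exp (-t) - 1) / t ^ 2)
      ((2 - x - Real.exp (-x) * (x + 2)) / x ^ 3) x := by
    intro x hx
    have h1 : HasDerivAt (fun t : ℝ => Real.exp (-t)) (Real.exp (-x) * (-1)) x :=
      (hasDerivAt_id x).neg.exp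
    have h2 := (((hasDerivAt_id x).add h1).sub_const 1).div (hasDerivAt_pow 2 x)
      (pow_ne_zero 2 hx.ne')
    refine h2.congr_deriv ?_
    simp only [id, Pi.add_apply]
    field_simp
    push_cast
    ring
  apply antitoneOn_of_deriv_nonpos (convex_Ioi 0)
  · exact fun x hx => (hd x hx).continuousAt.continuousWithinAt
  · rw [interior_Ioi]
    exact fun x hx => (hd x hx).differentiableAt.differentiableWithinAt
  · rw [interior_Ioi]
    intro x hx
    have hx' : 0 < x := hx
    rw [(hd x hx).deriv]
    exact div_nonpos_of_nonpos_of_nonneg (aux_k x hx'.le) (by positivity)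

/-- For `τ > 0` and `exp(−4τ) ≤ y ≤ exp(4τ)`,
`y − 1 − log y ≥ ((4τ + exp(−4τ) − 1)/(16τ²)) · (log y)²`. -/
theorem stmt_2 (τ y : ℝ) (hτ : 0 < τ)
    (hy1 : Real.exp (-(4 * τ)) ≤ y) (hy2 : y ≤ Real.exp (4 * τ)) :
    ((4 * τ + Real.exp (-(4 * τ)) - 1) / (16 * τ ^ 2)) * (Real.log y) ^ 2 ≤
      y - 1 - Real.log y := by
  have hy : 0 < y := (Real.exp_pos _).trans_le hy1
  obtain ⟨x, rfl⟩ : ∃ x, y = Real.exp x := ⟨Real.log y, (Real.exp_log hy).symm⟩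
  rw [Real.log_exp]
  rw [Real.exp_le_exp] at hy1
  have e : (16 * τ ^ 2) = (4 * τ) ^ 2 := by ring
  rw [e]
  have ha : 0 < 4 * τ := by linarith
  generalize 4 * τ = a at *
  rcases le_or_gt 0 x with hx | hx
  · have h1 := Real.quadratic_le_exp_of_nonneg hx
    have h2 := Real.quadratic_le_exp_of_nonneg ha.le
    have h3 : Real.exp (-a) * Real.exp a = 1 := by rw [← Real.exp_add]; simp
    have h4 : Real.exp (-a) ≤ 1 - a + a ^ 2 / 2 := by
      have h5 : Real.exp (-a) * (1 + a + a ^ 2 / 2) ≤ 1 := by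
        nlinarith [Real.exp_pos (-a)]
      have h6 : 0 < 1 + a + a ^ 2 / 2 := by positivity
      by_contra! h
      have := mul_lt_mul_of_pos_right h h6
      nlinarith [sq_nonneg (a ^ 2)]
    have hc : (a + Real.exp (-a) - 1) / a ^ 2 ≤ 1 / 2 := by
      rw [div_le_iff₀ (by positivity)]; linarith
    nlinarith [mul_le_mul_of_nonneg_right hc (sq_nonneg x)]
  · have h := aux_phi (Set.mem_Ioi.2 (neg_pos.2 hx)) (Set.mem_Ioi.2 ha) (by linarith)
    simp only [neg_neg, neg_sq] at h
    rw [le_div_iff₀ (by nlinarith)] at h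
    linarith
end

section
/- Let d ≥ 1, Λ > 0, x̄ > 0, ε ≥ 0, let t ≥ 1 be an integer, and let x₁, …, x_t ∈ ℝ^d with ‖x_s‖₂ ≤ x̄ for every s. Let θ*, θ, θ' ∈ ℝ^d with ‖θ*‖₂ ≤ 1, ‖θ‖₂ ≤ 1, ‖θ'‖₂ ≤ 1 and ‖θ − θ'‖₂ ≤ ε. Define G_t(θ) = Σ_{s=1}^t [ Λ·(exp(⟨θ*, x_s⟩) − exp(⟨θ, x_s⟩)) − Λ·exp(⟨θ*, x_s⟩)·(⟨θ*, x_s⟩ − ⟨θ, x_s⟩) ]. Then |G_t(θ)| ≤ |G_t(θ')| + Λ·exp(x̄)·(exp(ε·x̄) − 1 + ε·x̄)·t. -/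
open scoped RealInnerProductSpace BigOperators

theorem aux_exp (X δ b c : ℝ) (hb : b ≤ X) (h : c - b ≤ δ) (hδ : 0 ≤ δ) :
    Real.exp c - Real.exp b ≤ Real.exp X * (Real.exp δ - 1) := by
  have h1 : Real.exp c ≤ Real.exp b * Real.exp δ := by
    rw [← Real.exp_add]; exact Real.exp_le_exp.2 (by linarith)
  have h2 : Real.exp b ≤ Real.exp X := Real.exp_le_exp.2 hb
  have h3 : 1 ≤ Real.exp δ := Real.one_le_exp hδ
  nlinarith [mul_le_mul_of_nonneg_right h2 (sub_nonneg.2 h3)]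

theorem aux_term (L X δ a b c : ℝ) (hL : 0 < L) (ha : a ≤ X) (hb : b ≤ X) (hc : c ≤ X)
    (h : |b - c| ≤ δ) :
    |(L * (Real.exp a - Real.exp b) - L * Real.exp a * (a - b))
      - (L * (Real.exp a - Real.exp c) - L * Real.exp a * (a - c))|
      ≤ L * Real.exp X * (Real.exp δ - 1 + δ) := by
  have hδ : 0 ≤ δ := (abs_nonneg _).trans h
  have h1 : |Real.exp c - Real.exp b| ≤ Real.exp X * (Real.exp δ - 1) := by
    have := abs_le.1 h
    rw [abs_le]
    constructor
    · linarith [aux_exp X δ c b hc (by linarith) hδ]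
    · exact aux_exp X δ b c hb (by linarith) hδ
  have h2 : |Real.exp a * (b - c)| ≤ Real.exp X * δ := by
    rw [abs_mul, Real.abs_exp]
    exact mul_le_mul (Real.exp_le_exp.2 ha) h (abs_nonneg _) (Real.exp_pos _).le
  have h3 := (abs_add_le (Real.exp c - Real.exp b) (Real.exp a * (b - c))).trans (add_le_add h1 h2)
  have e : (L * (Real.exp a - Real.exp b) - L * Real.exp a * (a - b))
      - (L * (Real.exp a - Real.exp c) - L * Real.exp a * (a - c))
      = L * (Real.exp c - Real.exp b + Real.exp a * (b - c)) := by ring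
  rw [e, abs_mul, abs_of_pos hL]
  calc _ ≤ L * _ := mul_le_mul_of_nonneg_left h3 hL.le
    _ = _ := by ring

/-- **Lipschitz-type stability of the cumulative Poisson KL divergence in the
parameter θ** (Lemma `lm:dif_g` of the paper). -/
theorem stmt_4 {d : ℕ} (hd : 1 ≤ d) (Λ xbar ε : ℝ)
    (hΛ : 0 < Λ) (hxbar : 0 < xbar) (hε : 0 ≤ ε)
    (t : ℕ) (ht : 1 ≤ t) (x : ℕ → EuclideanSpace ℝ (Fin d))
    (hx : ∀ s ∈ Finset.range t, ‖x s‖ ≤ xbar)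
    (θstar θ θ' : EuclideanSpace ℝ (Fin d))
    (hθstar : ‖θstar‖ ≤ 1) (hθ : ‖θ‖ ≤ 1) (hθ' : ‖θ'‖ ≤ 1)
    (hθθ' : ‖θ - θ'‖ ≤ ε)
    (G : EuclideanSpace ℝ (Fin d) → ℝ)
    (hG : ∀ ϑ, G ϑ = ∑ s ∈ Finset.range t,
      (Λ * (Real.exp ⟪θstar, x s⟫ - Real.exp ⟪ϑ, x s⟫)
        - Λ * Real.exp ⟪θstar, x s⟫ * (⟪θstar, x s⟫ - ⟪ϑ, x s⟫))) :
    |G θ| ≤ |G θ'| + Λ * Real.exp xbar * (Real.exp (ε * xbar) - 1 + ε * xbar) * t := by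
  have hin : ∀ s ∈ Finset.range t, ∀ v : EuclideanSpace ℝ (Fin d), ‖v‖ ≤ 1 →
      (⟪v, x s⟫ : ℝ) ≤ xbar := fun s hs v hv =>
    (real_inner_le_norm v (x s)).trans (by
      have := mul_le_mul hv (hx s hs) (norm_nonneg _) zero_le_one
      linarith)
  have key : |G θ - G θ'| ≤ Λ * Real.exp xbar * (Real.exp (ε * xbar) - 1 + ε * xbar) * t := by
    rw [hG, hG, ← Finset.sum_sub_distrib]
    refine (Finset.abs_sum_le_sum_abs _ _).trans ?_
    refine (Finset.sum_le_card_nsmul _ _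
      (Λ * Real.exp xbar * (Real.exp (ε * xbar) - 1 + ε * xbar)) ?_).trans ?_
    · intro s hs
      refine aux_term _ _ _ _ _ _ hΛ (hin s hs _ hθstar) (hin s hs _ hθ) (hin s hs _ hθ') ?_
      rw [← inner_sub_left]
      exact (abs_real_inner_le_norm _ _).trans
        (mul_le_mul hθθ' (hx s hs) (norm_nonneg _) hε)
    · rw [Finset.card_range, nsmul_eq_mul, mul_comm]
  have := abs_sub_abs_le_abs_sub (G θ) (G θ')
  linarith
end

section
/- Let d ≥ 1, let K ≥ 1 be an integer, let S be a finite set with |S| ≤ K, let z_j ∈ ℝ^d with ‖z_j‖₂ ≤ 1 for all j ∈ S, let prices satisfy p_l ≤ p_j ≤ p_h with 0 < p_l ≤ p_h, and let v ∈ ℝ^d with ‖v‖₂ ≤ v̄ for some v̄ > 0. Define φ(v) = Σ_{j∈S} q(j; v)·z_j z_jᵀ − (Σ_{j∈S} q(j; v) z_j)(Σ_{j∈S} q(j; v) z_j)ᵀ. Then φ(v) − κ · Σ_{j∈S} z_j z_jᵀ is positive semidefinite, where κ = exp(−v̄ − p_h) / (K·exp(v̄ − p_l) + 1)². -/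
open scoped BigOperators

/-- **Explicit positive-definiteness lower bound for the MNL Fisher-information
kernel** with constant `κ = exp(−v̄ − p_h)/(K·exp(v̄ − p_l) + 1)²`
(equation (kappa) of the paper). Here `‖·‖₂` is written via
`√(Σᵢ (·)ᵢ²)` and `⟨z_j, v⟩ = Σᵢ z_j(i)·v(i)`. -/
theorem stmt_6 {d : ℕ} (hd : 1 ≤ d) (K : ℕ) (hK : 1 ≤ K)
    {ι : Type*} (S : Finset ι) (hS : S.card ≤ K)
    (z : ι → Fin d → ℝ) (hz : ∀ j ∈ S, Real.sqrt (∑ i, z j i ^ 2) ≤ 1)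
    (p : ι → ℝ) (pl ph : ℝ) (hpl : 0 < pl) (hplh : pl ≤ ph)
    (hp : ∀ j ∈ S, pl ≤ p j ∧ p j ≤ ph)
    (vbar : ℝ) (hvbar : 0 < vbar)
    (v : Fin d → ℝ) (hv : Real.sqrt (∑ i, v i ^ 2) ≤ vbar)
    (q : ι → ℝ)
    (hq : ∀ j, q j = Real.exp ((∑ i, z j i * v i) - p j) /
        (1 + ∑ k ∈ S, Real.exp ((∑ i, z k i * v i) - p k)))
    (κ : ℝ) (hκ : κ = Real.exp (-vbar - ph) / (K * Real.exp (vbar - pl) + 1) ^ 2) :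
    (((∑ j ∈ S, q j • Matrix.vecMulVec (z j) (z j))
      - Matrix.vecMulVec (∑ j ∈ S, q j • z j) (∑ j ∈ S, q j • z j))
      - κ • ∑ j ∈ S, Matrix.vecMulVec (z j) (z j)).PosSemidef := by
  classical
  set e : ι → ℝ := fun j => Real.exp ((∑ i, z j i * v i) - p j) with he
  set D : ℝ := 1 + ∑ k ∈ S, e k with hD
  have hepos : ∀ j, 0 < e j := fun j => Real.exp_pos _
  have hDpos : 0 < D := by
    have : 0 ≤ ∑ k ∈ S, e k := Finset.sum_nonneg fun k _ => (hepos k).le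
    rw [hD]; linarith
  have hqe : ∀ j, q j = e j / D := hq
  have hin : ∀ j ∈ S, |∑ i, z j i * v i| ≤ vbar := by
    intro j hj
    have h1 : (∑ i, z j i * v i) ^ 2 ≤ (∑ i, z j i ^ 2) * ∑ i, v i ^ 2 :=
      Finset.sum_mul_sq_le_sq_mul_sq _ _ _
    have h2 : ∑ i, z j i ^ 2 ≤ 1 := by
      have := (Real.sqrt_le_left (by norm_num)).1 (hz j hj)
      simpa using this
    have h3 : ∑ i, v i ^ 2 ≤ vbar ^ 2 := (Real.sqrt_le_left hvbar.le).1 hv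
    have h4 : 0 ≤ ∑ i, v i ^ 2 := Finset.sum_nonneg fun i _ => sq_nonneg _
    apply abs_le_of_sq_le_sq _ hvbar.le
    nlinarith
  have hlo : ∀ j ∈ S, Real.exp (-vbar - ph) ≤ e j := by
    intro j hj
    apply Real.exp_le_exp.2
    linarith [(abs_le.1 (hin j hj)).1, (hp j hj).2]
  have hup : ∀ j ∈ S, e j ≤ Real.exp (vbar - pl) := by
    intro j hj
    apply Real.exp_le_exp.2
    linarith [(abs_le.1 (hin j hj)).2, (hp j hj).1]
  have hDle : D ≤ K * Real.exp (vbar - pl) + 1 := by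
    have h1 : ∑ k ∈ S, e k ≤ S.card * Real.exp (vbar - pl) := by
      have := Finset.sum_le_card_nsmul S e _ hup
      simpa using this
    have h2 : (S.card : ℝ) * Real.exp (vbar - pl) ≤ K * Real.exp (vbar - pl) := by
      gcongr
    rw [hD]; linarith
  have hκle : ∀ j ∈ S, κ ≤ q j * (1 / D) := by
    intro j hj
    have : q j * (1 / D) = e j / D ^ 2 := by
      rw [hqe]; field_simp
    rw [this, hκ]
    have := hlo j hj
    have := (hepos j).le
    gcongr
  have hqsum : ∑ j ∈ S, q j = 1 - 1 / D := by
    simp only [hqe]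
    rw [← Finset.sum_div]
    field_simp
    rw [hD]; ring
  have hqnn : ∀ j, 0 ≤ q j := fun j => by
    rw [hqe]; exact div_nonneg (hepos j).le hDpos.le
  have hherm : ∀ a : Fin d → ℝ, (Matrix.vecMulVec a a).IsHermitian := by
    intro a
    ext i k
    simp [Matrix.vecMulVec_apply, mul_comm]
  have hsum : ∀ c : ι → ℝ, (∑ j ∈ S, c j • Matrix.vecMulVec (z j) (z j)).IsHermitian := by
    intro c
    ext i k
    simp [Matrix.vecMulVec_apply, Matrix.sum_apply, mul_comm]
  have hquad : ∀ (c : ι → ℝ) (x : Fin d → ℝ),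
      x ⬝ᵥ ((∑ j ∈ S, c j • Matrix.vecMulVec (z j) (z j)).mulVec x)
        = ∑ j ∈ S, c j * (z j ⬝ᵥ x) ^ 2 := by
    intro c x
    rw [Matrix.sum_mulVec, dotProduct_sum]
    refine Finset.sum_congr rfl fun j _ => ?_
    rw [Matrix.smul_mulVec, Matrix.vecMulVec_mulVec, dotProduct_smul]
    rw [op_smul_eq_smul, dotProduct_smul, dotProduct_comm x (z j), smul_eq_mul, smul_eq_mul, sq]
  rw [Finset.smul_sum]
  refine Matrix.PosSemidef.of_dotProduct_mulVec_nonneg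
    (((hsum q).sub (hherm _)).sub (hsum fun _ => κ)) fun x => ?_
  rw [star_trivial, Matrix.sub_mulVec, Matrix.sub_mulVec, dotProduct_sub, dotProduct_sub,
    hquad q, hquad (fun _ => κ), Matrix.vecMulVec_mulVec]
  have hm : (∑ j ∈ S, q j • z j) ⬝ᵥ x = ∑ j ∈ S, q j * (z j ⬝ᵥ x) := by
    rw [sum_dotProduct]
    simp
  have hmid : x ⬝ᵥ (MulOpposite.op ((∑ j ∈ S, q j • z j) ⬝ᵥ x) • ∑ j ∈ S, q j • z j)
      = (∑ j ∈ S, q j * (z j ⬝ᵥ x)) ^ 2 := by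
    rw [op_smul_eq_smul, dotProduct_smul, dotProduct_comm x, hm, smul_eq_mul, sq]
  rw [hmid]
  have hcs : (∑ j ∈ S, q j * (z j ⬝ᵥ x)) ^ 2
      ≤ (∑ j ∈ S, q j) * ∑ j ∈ S, q j * (z j ⬝ᵥ x) ^ 2 := by
    refine Finset.sum_sq_le_sum_mul_sum_of_sq_le_mul S (fun j _ => hqnn j)
      (fun j _ => mul_nonneg (hqnn j) (sq_nonneg _)) fun j _ => le_of_eq (by ring)
  have hfin : ∑ j ∈ S, κ * (z j ⬝ᵥ x) ^ 2 ≤ (1 / D) * ∑ j ∈ S, q j * (z j ⬝ᵥ x) ^ 2 := by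
    rw [Finset.mul_sum]
    refine Finset.sum_le_sum fun j hj => ?_
    have := mul_le_mul_of_nonneg_right (hκle j hj) (sq_nonneg (z j ⬝ᵥ x))
    linarith
  rw [hqsum] at hcs
  linarith
end

section
/- Let d ≥ 1, let K ≥ 1 be an integer, let S be a finite set with |S| ≤ K, let z_j ∈ ℝ^d with ‖z_j‖₂ ≤ 1 for all j ∈ S, let prices satisfy p_j ≥ p_l > 0 for all j ∈ S, and let τ > 0, v̄ > 0. Let v⁽¹⁾, v⁽²⁾ ∈ ℝ^d satisfy ‖v⁽²⁾‖₂ ≤ v̄ and ‖v⁽¹⁾ − v⁽²⁾‖₂ ≤ 2τ. Define φ(v) = Σ_{j∈S} q(j; v)·z_j z_jᵀ − Σ_{j,k∈S} q(j; v) q(k; v)·z_j z_kᵀ. Then c₈·φ(v⁽²⁾) − φ(v⁽¹⁾) is positive semidefinite, where c₈ = 3·(exp(4τ) − 1)·(K·exp(v̄ − p_l) + 1) + 1. -/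
open scoped BigOperators


theorem aux_cs {d : ℕ} (a b : Fin d → ℝ) (B : ℝ) (ha : Real.sqrt (∑ i, a i ^ 2) ≤ 1)
    (hb : Real.sqrt (∑ i, b i ^ 2) ≤ B) : ∑ i, a i * b i ≤ B := by
  refine (Real.sum_mul_le_sqrt_mul_sqrt Finset.univ a b).trans ?_
  have h0 := Real.sqrt_nonneg (∑ i, b i ^ 2)
  nlinarith [mul_le_mul_of_nonneg_right ha h0]

theorem aux_form {d : ℕ} {ι : Type*} (S : Finset ι) (z : ι → Fin d → ℝ) (q : ι → ℝ)
    (x : Fin d → ℝ) :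
    x ⬝ᵥ (((∑ j ∈ S, q j • Matrix.vecMulVec (z j) (z j))
        - ∑ j ∈ S, ∑ k ∈ S, (q j * q k) • Matrix.vecMulVec (z j) (z k)).mulVec x)
      = ∑ j ∈ S, q j * (z j ⬝ᵥ x) ^ 2 - (∑ j ∈ S, q j * (z j ⬝ᵥ x)) ^ 2 := by
  have key : ∀ j k, x ⬝ᵥ ((Matrix.vecMulVec (z j) (z k)).mulVec x)
      = (z j ⬝ᵥ x) * (z k ⬝ᵥ x) := by
    intro j k
    rw [Matrix.vecMulVec_mulVec]
    simp [dotProduct_comm x, mul_comm]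
  simp only [Matrix.sub_mulVec, Matrix.sum_mulVec, Matrix.smul_mulVec, dotProduct_sub,
    dotProduct_sum, dotProduct_smul, key, smul_eq_mul]
  congr 1
  · exact Finset.sum_congr rfl fun j _ => by ring
  · rw [sq, Finset.sum_mul_sum]
    exact Finset.sum_congr rfl fun j _ => Finset.sum_congr rfl fun k _ => by ring

theorem aux_symm {d : ℕ} {ι : Type*} (S : Finset ι) (z : ι → Fin d → ℝ) (q : ι → ℝ) :
    ((∑ j ∈ S, q j • Matrix.vecMulVec (z j) (z j))
        - ∑ j ∈ S, ∑ k ∈ S, (q j * q k) • Matrix.vecMulVec (z j) (z k)).IsHermitian := by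
  ext a b
  simp only [Matrix.conjTranspose_apply, Matrix.sub_apply, Matrix.sum_apply, Matrix.smul_apply,
    Matrix.vecMulVec_apply, smul_eq_mul, star_trivial]
  congr 1
  · exact Finset.sum_congr rfl fun j _ => by ring
  · rw [Finset.sum_comm]
    exact Finset.sum_congr rfl fun j _ => Finset.sum_congr rfl fun k _ => by ring

theorem aux_var {ι : Type*} (S : Finset ι) (a q1 q2 : ι → ℝ) (r : ℝ)
    (h : ∀ j ∈ S, q1 j ≤ r * q2 j) (h0 : 1 - ∑ j ∈ S, q1 j ≤ r * (1 - ∑ j ∈ S, q2 j)) :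
    ∑ j ∈ S, q1 j * a j ^ 2 - (∑ j ∈ S, q1 j * a j) ^ 2
      ≤ r * (∑ j ∈ S, q2 j * a j ^ 2 - (∑ j ∈ S, q2 j * a j) ^ 2) := by
  set m := ∑ j ∈ S, q2 j * a j with hm
  have e : ∀ q : ι → ℝ, ∑ j ∈ S, q j * (a j - m) ^ 2
      = ∑ j ∈ S, q j * a j ^ 2 - 2 * m * ∑ j ∈ S, q j * a j + m ^ 2 * ∑ j ∈ S, q j := by
    intro q
    clear_value m
    rw [Finset.mul_sum, Finset.mul_sum, ← Finset.sum_sub_distrib, ← Finset.sum_add_distrib]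
    exact Finset.sum_congr rfl fun j _ => by ring
  have h1 : ∑ j ∈ S, q1 j * (a j - m) ^ 2 ≤ r * ∑ j ∈ S, q2 j * (a j - m) ^ 2 := by
    rw [Finset.mul_sum]
    refine Finset.sum_le_sum fun j hj => ?_
    rw [← mul_assoc]
    exact mul_le_mul_of_nonneg_right (h j hj) (sq_nonneg _)
  rw [e q1, e q2, ← hm] at h1
  have h2 := mul_le_mul_of_nonneg_right h0 (sq_nonneg m)
  nlinarith [sq_nonneg (m - ∑ j ∈ S, q1 j * a j)]

/-- **Single-period Fisher-information comparison for the MNL kernel**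
(Lemma `lm:I_v_close_to_I_v_star` of the paper):
`c₈·φ(v⁽²⁾) − φ(v⁽¹⁾) ⪰ 0` with `c₈ = 3(exp(4τ) − 1)(K·exp(v̄ − p_l) + 1) + 1`,
where `φ(v) = Σ_j q(j;v) z_j z_jᵀ − Σ_{j,k} q(j;v) q(k;v) z_j z_kᵀ`. -/
theorem stmt_7 {d : ℕ} (hd : 1 ≤ d) (K : ℕ) (hK : 1 ≤ K)
    {ι : Type*} (S : Finset ι) (hS : S.card ≤ K)
    (z : ι → Fin d → ℝ) (hz : ∀ j ∈ S, Real.sqrt (∑ i, z j i ^ 2) ≤ 1)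
    (p : ι → ℝ) (pl : ℝ) (hpl : 0 < pl) (hp : ∀ j ∈ S, pl ≤ p j)
    (τ vbar : ℝ) (hτ : 0 < τ) (hvbar : 0 < vbar)
    (v₁ v₂ : Fin d → ℝ)
    (hv₂ : Real.sqrt (∑ i, v₂ i ^ 2) ≤ vbar)
    (hv₁₂ : Real.sqrt (∑ i, (v₁ i - v₂ i) ^ 2) ≤ 2 * τ)
    (q : (Fin d → ℝ) → ι → ℝ)
    (hq : ∀ v j, q v j = Real.exp ((∑ i, z j i * v i) - p j) /
        (1 + ∑ k ∈ S, Real.exp ((∑ i, z k i * v i) - p k)))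
    (φ : (Fin d → ℝ) → Matrix (Fin d) (Fin d) ℝ)
    (hφ : ∀ v, φ v = (∑ j ∈ S, q v j • Matrix.vecMulVec (z j) (z j))
        - ∑ j ∈ S, ∑ k ∈ S, (q v j * q v k) • Matrix.vecMulVec (z j) (z k))
    (c₈ : ℝ)
    (hc₈ : c₈ = 3 * (Real.exp (4 * τ) - 1) * (K * Real.exp (vbar - pl) + 1) + 1) :
    (c₈ • φ v₂ - φ v₁).PosSemidef := by
  set w : (Fin d → ℝ) → ι → ℝ := fun v j => Real.exp ((∑ i, z j i * v i) - p j) with hw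
  have hwpos : ∀ v j, 0 < w v j := fun v j => Real.exp_pos _
  have hq' : ∀ v j, q v j = w v j / (1 + ∑ k ∈ S, w v k) := hq
  have hWpos : ∀ v, 0 < 1 + ∑ k ∈ S, w v k := fun v => by
    have := Finset.sum_nonneg fun k (_ : k ∈ S) => (hwpos v k).le
    linarith
  have hq0 : ∀ v, 1 - ∑ j ∈ S, q v j = 1 / (1 + ∑ k ∈ S, w v k) := by
    intro v
    have hne := (hWpos v).ne'
    simp only [hq', ← Finset.sum_div]
    field_simp
    ring
  have hE1 : 1 ≤ Real.exp (2 * τ) := Real.one_le_exp (by linarith)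
  have hEE : Real.exp (4 * τ) = Real.exp (2 * τ) * Real.exp (2 * τ) := by
    rw [← Real.exp_add]; ring_nf
  have hle12 : ∀ j ∈ S, w v₁ j ≤ Real.exp (2 * τ) * w v₂ j := by
    intro j hj
    have := aux_cs (z j) (fun i => v₁ i - v₂ i) _ (hz j hj) hv₁₂
    simp only [mul_sub, Finset.sum_sub_distrib] at this
    simp only [hw, ← Real.exp_add]
    exact Real.exp_le_exp.2 (by linarith)
  have hle21 : ∀ j ∈ S, w v₂ j ≤ Real.exp (2 * τ) * w v₁ j := by
    intro j hj
    have := aux_cs (z j) (fun i => v₂ i - v₁ i) (2 * τ) (hz j hj)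
      (by simpa only [sub_sq_comm] using hv₁₂)
    simp only [mul_sub, Finset.sum_sub_distrib] at this
    simp only [hw, ← Real.exp_add]
    exact Real.exp_le_exp.2 (by linarith)
  have hW : 1 + ∑ k ∈ S, w v₂ k ≤ Real.exp (2 * τ) * (1 + ∑ k ∈ S, w v₁ k) := by
    have := Finset.sum_le_sum hle21
    rw [← Finset.mul_sum] at this
    linarith
  have hEpos := Real.exp_pos (2 * τ)
  have hinv : 1 / (1 + ∑ k ∈ S, w v₁ k) ≤ Real.exp (2 * τ) * (1 / (1 + ∑ k ∈ S, w v₂ k)) := by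
    rw [mul_one_div, div_le_div_iff₀ (hWpos _) (hWpos _)]
    linarith
  have hip := one_div_pos.2 (hWpos v₁)
  have hip2 := one_div_pos.2 (hWpos v₂)
  have hc : Real.exp (4 * τ) ≤ c₈ := by
    have h1 : 0 ≤ (K : ℝ) * Real.exp (vbar - pl) := by positivity
    have h2 : 1 ≤ Real.exp (4 * τ) := Real.one_le_exp (by linarith)
    rw [hc₈]
    nlinarith [mul_nonneg (sub_nonneg.2 h2) h1]
  have hr1 : ∀ j ∈ S, q v₁ j ≤ c₈ * q v₂ j := by
    intro j hj
    rw [hq', hq', div_eq_mul_one_div, div_eq_mul_one_div (w v₂ j)]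
    calc w v₁ j * (1 / (1 + ∑ k ∈ S, w v₁ k))
        ≤ (Real.exp (2 * τ) * w v₂ j) * (Real.exp (2 * τ) * (1 / (1 + ∑ k ∈ S, w v₂ k))) :=
          mul_le_mul (hle12 j hj) hinv hip.le (mul_pos hEpos (hwpos _ _)).le
      _ = Real.exp (4 * τ) * (w v₂ j * (1 / (1 + ∑ k ∈ S, w v₂ k))) := by rw [hEE]; ring
      _ ≤ _ := mul_le_mul_of_nonneg_right hc (mul_pos (hwpos _ _) hip2).le
  have hr0 : 1 - ∑ j ∈ S, q v₁ j ≤ c₈ * (1 - ∑ j ∈ S, q v₂ j) := by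
    rw [hq0, hq0]
    refine hinv.trans (mul_le_mul_of_nonneg_right (le_trans ?_ hc) hip2.le)
    rw [hEE]
    nlinarith
  refine Matrix.PosSemidef.of_dotProduct_mulVec_nonneg ?_ ?_
  · have hs : ∀ v, (φ v).IsHermitian := fun v => by rw [hφ]; exact aux_symm S z (q v)
    refine Matrix.IsHermitian.sub ?_ (hs v₁)
    rw [Matrix.IsHermitian, Matrix.conjTranspose_smul, (hs v₂).eq, star_trivial]
  · intro x
    have hv := aux_var S (fun j => z j ⬝ᵥ x) (q v₁) (q v₂) c₈ hr1 hr0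
    rw [star_trivial, Matrix.sub_mulVec, Matrix.smul_mulVec, dotProduct_sub, dotProduct_smul,
      hφ, hφ, aux_form, aux_form, smul_eq_mul]
    linarith
end

section
/- Let μ be a real number with μ ≥ 1, and let M be a Poisson random variable with mean μ, i.e. P(M = k) = exp(−μ)·μ^k / k! for every nonnegative integer k. Then P(M ≥ ⌈μ⌉) = Σ_{k ≥ ⌈μ⌉} exp(−μ)·μ^k / k! ≥ 1/2 − 1/√(2π). -/
open Real in
lemma aux_fact (j : ℕ) :
    Real.log (Nat.factorial (j+1)) ≤ 1 + 1/2 * Real.log ((j:ℝ)+1) + ((j:ℝ)+1) * Real.log ((j:ℝ)+1) - ((j:ℝ)+1) := by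
  have h := Stirling.log_stirlingSeq'_antitone (Nat.zero_le j)
  simp only [Function.comp, Nat.succ_eq_add_one, zero_add] at h
  rw [Stirling.log_stirlingSeq_formula, Stirling.log_stirlingSeq_formula] at h
  have hj : ((j:ℝ)+1) ≠ 0 := by positivity
  push_cast at h
  rw [Real.log_mul (by norm_num) hj, Real.log_div hj (Real.exp_pos _).ne', Real.log_exp] at h
  simp at h
  linarith

lemma aux_bound (μ : ℝ) (n : ℕ) (hμ : 1 ≤ μ) (h1 : (n:ℝ) ≤ μ) (h2 : μ ≤ (n:ℝ) + 1) :
    Real.exp (-2) ≤ μ * (Real.exp (-μ) * μ ^ n / (Nat.factorial n)) ^ 2 := by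
  have hpos : 0 < μ := by linarith
  have hf : (0:ℝ) < Nat.factorial n := by positivity
  have key : Real.log (Nat.factorial n) - 1 ≤ ((n:ℝ)+1/2) * Real.log μ - μ := by
    have hn1 : Real.log (Nat.factorial n) - 1 ≤ ((n:ℝ)+1/2) * Real.log ((n:ℝ)+1) - ((n:ℝ)+1) := by
      have := aux_fact n
      rw [Nat.factorial_succ] at this
      push_cast at this
      rw [Real.log_mul (by positivity) (by positivity)] at this
      linarith
    rcases n with _ | j
    · have : μ = 1 := by simp at h2; linarith
      subst this
      simp
    · have hn0 := aux_fact j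
      have hc : ConcaveOn ℝ (Set.Ioi 0) (fun x : ℝ => (((j+1:ℕ):ℝ)+1/2) * Real.log x - x) :=
        (strictConcaveOn_log_Ioi.concaveOn.smul (by positivity : (0:ℝ) ≤ ((j+1:ℕ):ℝ)+1/2)).sub
          (convexOn_id (convex_Ioi 0))
      have := hc.min_le_of_mem_Icc (x := ((j+1:ℕ):ℝ)) (y := ((j+1:ℕ):ℝ)+1) (z := μ)
        (by simp only [Set.mem_Ioi]; positivity) (by simp only [Set.mem_Ioi]; positivity) ⟨h1, h2⟩
      refine le_trans (le_min ?_ hn1) this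
      push_cast
      linarith
  have e : μ * (Real.exp (-μ) * μ ^ n / (Nat.factorial n)) ^ 2
      = Real.exp (2 * (((n:ℝ)+1/2) * Real.log μ - μ - Real.log (Nat.factorial n))) := by
    rw [← Real.exp_log (show 0 < μ * (Real.exp (-μ) * μ ^ n / (Nat.factorial n)) ^ 2 by positivity)]
    congr 1
    rw [Real.log_mul (by positivity) (by positivity), Real.log_pow, Real.log_div (by positivity)
      (by positivity), Real.log_mul (by positivity) (by positivity), Real.log_exp, Real.log_pow]
    push_cast
    ring
  rw [e]
  apply Real.exp_le_exp.mpr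
  linarith

lemma aux_shift (f g : ℕ → ℝ) (s : ℝ) (hg : HasSum g s) (h0 : f 0 = 0) (h : ∀ k, f (k+1) = g k) :
    HasSum f s := by
  have : HasSum (fun k => f (k+1)) s := by simpa only [h] using hg
  have := (hasSum_nat_add_iff (f := f) 1).mp this
  simpa [h0] using this

lemma aux_num : 1 / 2 - 1 / Real.sqrt (2 * Real.pi) ≤ Real.exp (-2) := by
  have h1 : Real.sqrt (2 * Real.pi) ≤ 2.6 := by
    rw [Real.sqrt_le_left (by norm_num)]
    have := Real.pi_lt_d2
    norm_num at *
    linarith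
  have h2 : 1 / 2.6 ≤ 1 / Real.sqrt (2 * Real.pi) :=
    one_div_le_one_div_of_le (by positivity) h1
  have h3 : Real.exp 2 ≤ 2.72 ^ 2 := by
    have : Real.exp 2 = Real.exp 1 ^ 2 := by rw [← Real.exp_nat_mul]; norm_num
    rw [this]
    have := Real.exp_one_lt_d9
    gcongr
    linarith
  have h4 : 1 / (2.72 ^ 2 : ℝ) ≤ Real.exp (-2) := by
    rw [Real.exp_neg, ← one_div]
    exact one_div_le_one_div_of_le (by positivity) h3
  norm_num at *
  linarith

lemma aux_main (μ : ℝ) (n : ℕ) (hpos : 0 < μ) :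
    μ * (Real.exp (-μ) * μ ^ n / (Nat.factorial n)) ^ 2 ≤
      ∑' k : ℕ, if n + 1 ≤ k then Real.exp (-μ) * μ ^ k / (Nat.factorial k) else 0 := by
  set p : ℕ → ℝ := fun k => Real.exp (-μ) * μ ^ k / (Nat.factorial k) with hp
  have p0 : ∀ k, 0 ≤ p k := fun k => by simp only [hp]; positivity
  have ps : ∀ k : ℕ, ((k:ℝ)+1) * p (k+1) = μ * p k := fun k => by
    simp only [hp, Nat.factorial_succ]
    push_cast
    field_simp
    ring
  have H0 : HasSum p 1 := by
    have h := (NormedSpace.expSeries_div_hasSum_exp (𝔸 := ℝ) μ).mul_left (Real.exp (-μ))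
    rw [← Real.exp_eq_exp_ℝ, ← Real.exp_add, neg_add_cancel, Real.exp_zero] at h
    simpa only [hp, mul_div_assoc] using h
  have H1 : HasSum (fun k : ℕ => (k:ℝ) * p k) (μ * 1) :=
    aux_shift _ _ _ (H0.mul_left μ) (by simp) (fun k => by push_cast; exact ps k)
  have H2 : HasSum (fun k : ℕ => (k:ℝ) * ((k:ℝ) - 1) * p k) (μ * (μ * 1)) :=
    aux_shift _ _ _ (H1.mul_left μ) (by simp)
      (fun k => by push_cast; linear_combination (k:ℝ) * ps k)
  have HV : HasSum (fun k : ℕ => ((k:ℝ) - μ)^2 * p k) μ := by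
    have := (H2.add (H1.mul_left (1 - 2*μ))).add (H0.mul_left (μ^2))
    convert this using 1
    · funext k; ring
    · ring
  have S : ∀ m : ℕ, Summable (fun k => if m ≤ k then p k else 0) := fun m =>
    Summable.of_nonneg_of_le (fun k => by split_ifs <;> simp [p0])
      (fun k => by split_ifs <;> simp [p0]) H0.summable
  set T := ∑' k : ℕ, if n + 1 ≤ k then p k else 0 with hT
  have HT : HasSum (fun k => if n + 1 ≤ k then p k else 0) T := (S (n+1)).hasSum
  have HT' : HasSum (fun k => if n ≤ k then p k else 0) (T + p n) := by
    have := HT.add (hasSum_ite_eq n (p n))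
    convert this using 1
    funext k
    rcases lt_trichotomy k n with h | h | h
    · simp [h.ne, not_le.mpr h, show ¬ (n+1 ≤ k) by omega]
    · simp [h]
    · simp [h.ne', h.le, show (n+1 ≤ k) by omega]
  have HK : HasSum (fun k : ℕ => if n + 1 ≤ k then (k:ℝ) * p k else 0) (μ * (T + p n)) :=
    aux_shift _ _ _ (HT'.mul_left μ) (by simp) (fun k => by
      by_cases h : n ≤ k
      · simp [h, ps]
      · simp [h])
  have HC := ((HK.sub (HT.mul_left μ)).mul_left (2 * p n)).sub (HV.mul_left (p n ^ 2))
  have := hasSum_le (fun k => ?_) HC HT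
  · change μ * (p n)^2 ≤ T
    linarith
  · by_cases h : n + 1 ≤ k
    · simp only [h, if_true]
      nlinarith [mul_nonneg (sq_nonneg (1 - p n * ((k:ℝ) - μ))) (p0 k)]
    · simp only [h, if_false]
      nlinarith [mul_nonneg (sq_nonneg (p n * ((k:ℝ) - μ))) (p0 k)]


/-- **Poisson tail lower bound** (Lemma `lm:poi_bound` of the paper):
if `M ~ Poisson(μ)` with `μ ≥ 1`, then
`P(M ≥ ⌈μ⌉) = Σ_{k ≥ ⌈μ⌉} exp(−μ)·μ^k/k! ≥ 1/2 − 1/√(2π)`. -/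
theorem stmt_8 (μ : ℝ) (hμ : 1 ≤ μ) :
    1 / 2 - 1 / Real.sqrt (2 * Real.pi) ≤
      ∑' k : ℕ, if ⌈μ⌉₊ ≤ k then Real.exp (-μ) * μ ^ k / (Nat.factorial k) else 0 := by
  obtain ⟨n, hn⟩ : ∃ n, ⌈μ⌉₊ = n + 1 :=
    Nat.exists_eq_succ_of_ne_zero (Nat.ceil_pos.mpr (by linarith)).ne'
  rw [hn]
  have h2 : μ ≤ (n:ℝ) + 1 := by
    have := Nat.le_ceil μ
    rw [hn] at this
    exact_mod_cast this
  have h1 : (n:ℝ) ≤ μ := (Nat.lt_ceil.mp (by omega)).le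
  exact aux_num.trans ((aux_bound μ n hμ h1 h2).trans (aux_main μ n (by linarith)))
end

section
/- Define H(p) = −p·log p − (1 − p)·log(1 − p) for p ∈ (0,1). Let N, K, d_z be positive integers with N > d_z and log((N − d_z)/K) ≥ (1/4)·log 3 + 4·H(1/4). Set d = min{ ⌊(log((N − d_z)/K) − (1/4)·log 3)/H(1/4)⌋, d_z } and K̄ = ⌊(d + 1)/4⌋. Then K·C(d, K̄) + d_z − d ≤ N, where C(d, K̄) is the binomial coefficient. -/
/-- **Combinatorial feasibility of the adversarial catalog**
(Lemma `lem:catalog-feasible-phi` of the paper). With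
`H(p) = −p·log p − (1−p)·log(1−p)`,
`d = min{⌊(log((N−d_z)/K) − ¼·log 3)/H(1/4)⌋, d_z}` and `K̄ = ⌊(d+1)/4⌋`,
one has `K·C(d, K̄) + d_z − d ≤ N`. -/
theorem stmt_11 (N K dz : ℕ) (hN : 0 < N) (hK : 0 < K) (hdz : 0 < dz)
    (hNdz : dz < N)
    (H : ℝ → ℝ)
    (hH : ∀ p : ℝ, H p = -p * Real.log p - (1 - p) * Real.log (1 - p))
    (hcond : (1 / 4) * Real.log 3 + 4 * H (1 / 4) ≤
      Real.log (((N : ℝ) - dz) / K))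
    (d Kbar : ℕ)
    (hd : d = min
      ⌊(Real.log (((N : ℝ) - dz) / K) - (1 / 4) * Real.log 3) / H (1 / 4)⌋₊ dz)
    (hKbar : Kbar = (d + 1) / 4) :
    K * Nat.choose d Kbar + dz - d ≤ N := by
  have l3 : 0 < Real.log 3 := Real.log_pos (by norm_num)
  have l34 : Real.log 3 < Real.log 4 := Real.log_lt_log (by norm_num) (by norm_num)
  have hH4 : H (1 / 4) = Real.log 4 - 3 / 4 * Real.log 3 := by
    rw [hH]
    have e1 : Real.log (1 / 4) = - Real.log 4 := by
      rw [one_div, Real.log_inv]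
    have e2 : Real.log (1 - 1 / 4) = Real.log 3 - Real.log 4 := by
      rw [← Real.log_div (by norm_num) (by norm_num)]
      norm_num
    rw [e1, e2]
    ring
  have hpos : 0 < H (1 / 4) := by rw [hH4]; linarith
  have hdle : (d : ℝ) * H (1 / 4) ≤
      Real.log (((N : ℝ) - dz) / K) - (1 / 4) * Real.log 3 := by
    rw [← le_div_iff₀ hpos]
    refine le_trans ?_ (Nat.floor_le (div_nonneg (by linarith) hpos.le))
    exact_mod_cast hd.le.trans (min_le_left _ _)
  have hk : Kbar ≤ d := by omega
  have hk4 : 4 * (Kbar : ℝ) ≤ d + 1 := by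
    have : 4 * Kbar ≤ d + 1 := by omega
    exact_mod_cast this
  have hc0 : 0 < Nat.choose d Kbar := Nat.choose_pos hk
  have hc0' : (0 : ℝ) < Nat.choose d Kbar := by exact_mod_cast hc0
  have hbin : (Nat.choose d Kbar : ℝ) * 3 ^ (d - Kbar) ≤ 4 ^ d := by
    have h := add_pow (1 : ℝ) 3 d
    have h2 := Finset.single_le_sum
      (f := fun m => (1 : ℝ) ^ m * 3 ^ (d - m) * (Nat.choose d m : ℝ))
      (s := Finset.range (d + 1)) (fun i _ => by positivity)
      (Finset.mem_range.2 (Nat.lt_succ_of_le hk))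
    rw [← h] at h2
    norm_num at h2
    linarith
  have hlog := Real.log_le_log (by positivity) hbin
  rw [Real.log_mul hc0'.ne' (by positivity), Real.log_pow, Real.log_pow,
    Nat.cast_sub hk] at hlog
  have hKr : (0 : ℝ) < K := by exact_mod_cast hK
  have hNd : (0 : ℝ) < (N : ℝ) - dz := by
    have : (dz : ℝ) < N := by exact_mod_cast hNdz
    linarith
  have hfin : Real.log (Nat.choose d Kbar : ℝ) ≤ Real.log (((N : ℝ) - dz) / K) := by
    rw [hH4] at hdle
    have := mul_le_mul_of_nonneg_right hk4 l3.le
    nlinarith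
  have h1 := (Real.log_le_log_iff hc0' (div_pos hNd hKr)).1 hfin
  rw [le_div_iff₀ hKr] at h1
  have h2 : K * Nat.choose d Kbar + dz ≤ N := by
    have : (K : ℝ) * Nat.choose d Kbar + dz ≤ N := by linarith
    exact_mod_cast this
  omega
end

section
/- Let d ≥ 1 and T ≥ 1 be integers, let V₀ be a d×d real symmetric positive definite matrix, let M₁, …, M_T be d×d real symmetric positive semidefinite matrices, and set V_t = V₀ + Σ_{s=1}^t M_s for 1 ≤ t ≤ T. Then Σ_{t=1}^T log(1 + ‖V_{t−1}^{−1/2} M_t V_{t−1}^{−1/2}‖_op) ≤ log(det V_T) − log(det V₀). -/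
open scoped Matrix.Norms.L2Operator BigOperators

theorem aux_norm_le_det {d : ℕ} (A : Matrix (Fin d) (Fin d) ℝ) (hA : A.PosSemidef) :
    1 + ‖A‖ ≤ (1 + A).det := by
  set U := hA.isHermitian.eigenvectorUnitary with hU
  set l := hA.isHermitian.eigenvalues with hl
  have hl0 : ∀ i, 0 ≤ l i := hA.eigenvalues_nonneg
  have hs : A = (U : Matrix (Fin d) (Fin d) ℝ) * Matrix.diagonal l
      * star (U : Matrix (Fin d) (Fin d) ℝ) := by
    have := hA.isHermitian.spectral_theorem
    rw [Unitary.conjStarAlgAut_apply] at this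
    exact this
  have hUU : (U : Matrix (Fin d) (Fin d) ℝ) * star (U : Matrix (Fin d) (Fin d) ℝ) = 1 :=
    Unitary.coe_mul_star_self U
  have hUU' : star (U : Matrix (Fin d) (Fin d) ℝ) * (U : Matrix (Fin d) (Fin d) ℝ) = 1 :=
    Unitary.coe_star_mul_self U
  have hn : ‖A‖ = ‖l‖ := by
    rw [← Matrix.l2_opNorm_diagonal (𝕜 := ℝ) l, hs, ← Unitary.coe_star,
      CStarRing.norm_mul_coe_unitary, CStarRing.norm_coe_unitary_mul]
  have hdet : (1 + A).det = ∏ i, (1 + l i) := by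
    rw [hs, mul_assoc, Matrix.det_one_add_mul_comm, mul_assoc, hUU', mul_one,
      ← Matrix.diagonal_one, Matrix.diagonal_add, Matrix.det_diagonal]
  have hp : ∀ i, 1 + l i ≤ ∏ i, (1 + l i) := by
    intro i
    rw [← Finset.mul_prod_erase _ _ (Finset.mem_univ i)]
    apply le_mul_of_one_le_right (by linarith [hl0 i])
    exact Finset.one_le_prod fun j _ => by linarith [hl0 j]
  have h1 : 1 ≤ ∏ i, (1 + l i) :=
    Finset.one_le_prod fun j _ => by linarith [hl0 j]
  rw [hn, hdet]
  have : ‖l‖ ≤ ∏ i, (1 + l i) - 1 := by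
    rw [pi_norm_le_iff_of_nonneg (by linarith)]
    intro i
    rw [Real.norm_of_nonneg (hl0 i)]
    linarith [hp i]
  linarith

theorem aux_step {d : ℕ} (V M W : Matrix (Fin d) (Fin d) ℝ) (hV : V.PosDef)
    (hM : M.PosSemidef) (hWp : W.PosSemidef) (hW : W * W * V = 1) :
    Real.log (1 + ‖W * M * W‖) ≤ Real.log (V + M).det - Real.log V.det := by
  have hA : (W * M * W).PosSemidef := by
    have := hM.mul_mul_conjTranspose_same W
    rwa [hWp.isHermitian.eq] at this
  have h1 : W * V * W = 1 := by
    rw [mul_assoc] at hW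
    exact mul_eq_one_comm.mp hW
  have h2 : 1 + W * M * W = W * (V + M) * W := by
    rw [mul_add, add_mul, h1]
  have h3 := congrArg Matrix.det h2
  have h4 := congrArg Matrix.det h1
  simp only [Matrix.det_mul, Matrix.det_one] at h3 h4
  have hle := aux_norm_le_det _ hA
  have hv := hV.det_pos
  have hvm := (hV.add_posSemidef hM).det_pos
  rw [← Real.log_div hvm.ne' hv.ne']
  apply Real.log_le_log (by positivity)
  refine hle.trans (le_of_eq ?_)
  rw [h3, eq_div_iff hv.ne']
  linear_combination (V + M).det * h4

/-- **Determinant-telescoping (elliptical potential) inequality**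
(core of Lemmas 8 and 9 of the paper). Here `W t` is the inverse square root
`(V t)^{−1/2}` of the positive definite matrix `V t`, characterized as the
unique positive semidefinite matrix with `W t · W t · V t = 1`, and `‖·‖` is
the ℓ₂ operator (spectral) norm on matrices. -/
theorem stmt_12 {d T : ℕ} (hd : 1 ≤ d) (hT : 1 ≤ T)
    (V₀ : Matrix (Fin d) (Fin d) ℝ) (hV₀ : V₀.PosDef)
    (M : ℕ → Matrix (Fin d) (Fin d) ℝ) (hM : ∀ t, (M t).PosSemidef)
    (V : ℕ → Matrix (Fin d) (Fin d) ℝ)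
    (hV : ∀ t, V t = V₀ + ∑ s ∈ Finset.Icc 1 t, M s)
    (W : ℕ → Matrix (Fin d) (Fin d) ℝ)
    (hWpsd : ∀ t, (W t).PosSemidef)
    (hW : ∀ t, W t * W t * V t = 1) :
    ∑ t ∈ Finset.Icc 1 T, Real.log (1 + ‖W (t - 1) * M t * W (t - 1)‖) ≤
      Real.log (V T).det - Real.log (V 0).det := by
  have hpd : ∀ t, (V t).PosDef := by
    intro t
    rw [hV]
    exact hV₀.add_posSemidef (Matrix.posSemidef_sum _ fun s _ => hM s)
  have hsucc : ∀ t, V (t + 1) = V t + M (t + 1) := by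
    intro t
    rw [hV, hV, Finset.sum_Icc_succ_top (by omega), add_assoc]
  clear hT
  induction T with
  | zero => simp
  | succ n ih =>
    rw [Finset.sum_Icc_succ_top (by omega)]
    have := aux_step (V n) (M (n + 1)) (W n) (hpd n) (hM _) (hWpsd n) (hW n)
    rw [← hsucc] at this
    simp only [Nat.add_sub_cancel]
    linarith
end

section
/- Let K ≥ 1 be an integer, let m₁ and m₂ be nonnegative integers with m₁ + m₂ = K, let 0 < ε ≤ 1, and let p, p_l, p_h be reals with 0 < p_l ≤ p ≤ p_h. Then K·p·exp(ε − p)/(1 + K·exp(ε − p)) − (m₁·p·exp(ε − p) + m₂·p·exp(−p))/(1 + m₁·exp(ε − p) + m₂·exp(−p)) ≥ m₂·ε·p_l·exp(−p_h)/(1 + K·exp(1 − p_l))². -/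
/-- **Per-customer revenue gap for the first adversarial instance**
(proved inside Lemma `lm:regret_lower_bound_tilde` of the paper), with
constant `c₁₀ = p_l·exp(−p_h)/(1 + K·exp(1 − p_l))²`. -/
theorem stmt_14 (K : ℕ) (hK : 1 ≤ K) (m₁ m₂ : ℕ) (hm : m₁ + m₂ = K)
    (ε : ℝ) (hε0 : 0 < ε) (hε1 : ε ≤ 1)
    (p pl ph : ℝ) (hpl : 0 < pl) (hplp : pl ≤ p) (hpph : p ≤ ph) :
    (m₂ : ℝ) * ε * pl * Real.exp (-ph) / (1 + K * Real.exp (1 - pl)) ^ 2 ≤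
      K * p * Real.exp (ε - p) / (1 + K * Real.exp (ε - p))
        - (m₁ * p * Real.exp (ε - p) + m₂ * p * Real.exp (-p)) /
          (1 + m₁ * Real.exp (ε - p) + m₂ * Real.exp (-p)) := by
  have hKr : (K : ℝ) = m₁ + m₂ := by rw [← hm]; push_cast; ring
  have h1 : (0 : ℝ) ≤ m₁ := Nat.cast_nonneg _
  have h2 : (0 : ℝ) ≤ m₂ := Nat.cast_nonneg _
  have hab : ε * Real.exp (-p) ≤ Real.exp (ε - p) - Real.exp (-p) := by
    have h : Real.exp (ε - p) = Real.exp ε * Real.exp (-p) := by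
      rw [← Real.exp_add]; ring_nf
    rw [h]
    nlinarith [Real.add_one_le_exp ε, Real.exp_pos (-p)]
  have hbh : Real.exp (-ph) ≤ Real.exp (-p) := Real.exp_le_exp.mpr (by linarith)
  have hac : Real.exp (ε - p) ≤ Real.exp (1 - pl) := Real.exp_le_exp.mpr (by linarith)
  have hh := Real.exp_pos (-ph)
  rw [hKr]
  generalize Real.exp (ε - p) = a at *
  generalize Real.exp (-p) = b at *
  generalize Real.exp (-ph) = h at *
  generalize Real.exp (1 - pl) = c at *
  generalize (m₁ : ℝ) = x at *
  generalize (m₂ : ℝ) = y at *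
  have hb : 0 < b := by linarith
  have hba : b ≤ a := by nlinarith
  have ha : 0 < a := by linarith
  have hA : 0 < 1 + (x + y) * a := by positivity
  have hB : 0 < 1 + x * a + y * b := by positivity
  have hAD : 1 + (x + y) * a ≤ 1 + (x + y) * c := by gcongr
  have hBD : 1 + x * a + y * b ≤ 1 + (x + y) * c := by
    nlinarith [mul_le_mul_of_nonneg_left hba h2]
  have e : (x + y) * p * a / (1 + (x + y) * a) - (x * p * a + y * p * b) / (1 + x * a + y * b)
      = (y * p * (a - b)) / ((1 + (x + y) * a) * (1 + x * a + y * b)) := by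
    rw [div_sub_div _ _ hA.ne' hB.ne']
    congr 1
    ring
  rw [e]
  have hp : 0 < p := by linarith
  have hd : ε * h ≤ a - b := le_trans (by gcongr) hab
  apply div_le_div₀
  · have : 0 ≤ a - b := by linarith
    positivity
  · calc y * ε * pl * h = y * pl * (ε * h) := by ring
      _ ≤ y * p * (a - b) := by gcongr
  · positivity
  · rw [sq]
    exact mul_le_mul hAD hBD hB.le (by linarith)
end

section
/- Let K ≥ 1 be an integer, let v̄ > 0, let p, p_l, p_h be reals with 0 < p_l ≤ p ≤ p_h, and let a, b be reals with 0 ≤ b ≤ a ≤ v̄. Then K·p·exp(a − p)/(K·exp(a − p) + 1) − K·p·exp(b − p)/(K·exp(b − p) + 1) ≥ (K·p_l·exp(−p_h)/(K·exp(v̄ − p_l) + 1)²)·(a − b). -/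
/-- **Per-customer revenue gap for the second adversarial instance**
(key inequality of Lemma `lm:regret_lower_bound_tilde2` of the paper), with
constant `c₁₂ = K·p_l·exp(−p_h)/(K·exp(v̄ − p_l) + 1)²`. -/
theorem stmt_15 (K : ℕ) (hK : 1 ≤ K) (vbar : ℝ) (hvbar : 0 < vbar)
    (p pl ph : ℝ) (hpl : 0 < pl) (hplp : pl ≤ p) (hpph : p ≤ ph)
    (a b : ℝ) (hb0 : 0 ≤ b) (hba : b ≤ a) (havbar : a ≤ vbar) :
    (K * pl * Real.exp (-ph) / (K * Real.exp (vbar - pl) + 1) ^ 2) * (a - b) ≤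
      K * p * Real.exp (a - p) / (K * Real.exp (a - p) + 1)
        - K * p * Real.exp (b - p) / (K * Real.exp (b - p) + 1) := by
  have hA : Real.exp (a - p) ≤ Real.exp (vbar - pl) := Real.exp_le_exp.mpr (by linarith)
  have hB : Real.exp (b - p) ≤ Real.exp (vbar - pl) := Real.exp_le_exp.mpr (by linarith)
  have hBl : Real.exp (-ph) ≤ Real.exp (b - p) := Real.exp_le_exp.mpr (by linarith)
  have hAB : Real.exp (a - p) = Real.exp (b - p) * Real.exp (a - b) := by
    rw [← Real.exp_add]; congr 1; ring
  have h1 : a - b + 1 ≤ Real.exp (a - b) := Real.add_one_le_exp _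
  have hA0 := Real.exp_pos (a - p)
  have hB0 := Real.exp_pos (b - p)
  have hP0 := Real.exp_pos (-ph)
  have hd : 0 ≤ a - b := by linarith
  have hp : 0 < p := by linarith
  have h2 : Real.exp (-ph) * (a - b) ≤ Real.exp (a - p) - Real.exp (b - p) := by
    have e1 := mul_le_mul_of_nonneg_right hBl hd
    have e2 := mul_le_mul_of_nonneg_left h1 hB0.le
    rw [hAB]; linarith
  have hK0 : (0 : ℝ) ≤ K := Nat.cast_nonneg K
  generalize Real.exp (a - p) = A at *
  generalize Real.exp (b - p) = B at *
  generalize Real.exp (vbar - pl) = M at *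
  generalize Real.exp (-ph) = P at *
  generalize (K : ℝ) = k at *
  have hgap : k * p * A / (k * A + 1) - k * p * B / (k * B + 1)
      = k * p * (A - B) / ((k * A + 1) * (k * B + 1)) := by
    have : k * A + 1 ≠ 0 := by positivity
    have : k * B + 1 ≠ 0 := by positivity
    field_simp
    ring
  rw [hgap, div_mul_eq_mul_div]
  have hABn : 0 ≤ A - B := le_trans (by positivity) h2
  apply div_le_div₀
  · positivity
  · calc k * pl * P * (a - b) = k * pl * (P * (a - b)) := by ring
      _ ≤ k * p * (A - B) := by gcongr
  · positivity
  · rw [sq]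
    have : 0 < M := by linarith
    gcongr
end

section
/- Let d ≥ 1, Λ > 0, x̄ > 0, ω ≥ 0, let m ≥ 1 be an integer, and let x₁, …, x_m, x ∈ ℝ^d satisfy ‖x_s‖₂ ≤ x̄ for all s and ‖x‖₂ ≤ x̄. Let θ*, θ̂ ∈ ℝ^d with ‖θ*‖₂ ≤ 1 and set δ = ‖θ̂ − θ*‖₂. Define I = Σ_{s=1}^m Λ·exp(⟨θ*, x_s⟩)·x_s x_sᵀ and M = Λ·exp(⟨θ*, x⟩)·x xᵀ, and assume I is positive definite. If (θ̂ − θ*)ᵀ I (θ̂ − θ*) ≤ ω, then Λ·|exp(⟨θ̂, x⟩) − exp(⟨θ*, x⟩)| ≤ √( ω·Λ·exp((2δ + 1)·x̄) · ‖I^{−1/2} M I^{−1/2}‖_op ). -/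
open scoped Matrix.Norms.L2Operator BigOperators
open Matrix

theorem aux_dot (d : ℕ) (a b : Fin d → ℝ) :
    |a ⬝ᵥ b| ≤ Real.sqrt (∑ i, a i ^ 2) * Real.sqrt (∑ i, b i ^ 2) := by
  rw [← Real.sqrt_mul (Finset.sum_nonneg fun i _ => sq_nonneg _)]
  apply Real.abs_le_sqrt
  exact Finset.sum_mul_sq_le_sq_mul_sq _ _ _

theorem aux_quad (d : ℕ) (A : Matrix (Fin d) (Fin d) ℝ) (u : Fin d → ℝ) :
    u ⬝ᵥ A *ᵥ u ≤ ‖A‖ * (u ⬝ᵥ u) := by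
  have h := Matrix.l2_opNorm_mulVec A (WithLp.toLp 2 u)
  have h2 := aux_dot d u (A *ᵥ u)
  have e1 : ‖(WithLp.toLp 2 u : EuclideanSpace ℝ (Fin d))‖ = Real.sqrt (∑ i, u i ^ 2) := by
    simp [EuclideanSpace.norm_eq]
  have e2 : ‖(WithLp.toLp 2 (A *ᵥ u) : EuclideanSpace ℝ (Fin d))‖
      = Real.sqrt (∑ i, (A *ᵥ u) i ^ 2) := by
    simp [EuclideanSpace.norm_eq]
  have h' : Real.sqrt (∑ i, (A *ᵥ u) i ^ 2) ≤ ‖A‖ * Real.sqrt (∑ i, u i ^ 2) := by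
    rw [← e1, ← e2]; exact h
  have e3 : u ⬝ᵥ u = Real.sqrt (∑ i, u i ^ 2) * Real.sqrt (∑ i, u i ^ 2) := by
    rw [Real.mul_self_sqrt (Finset.sum_nonneg fun i _ => sq_nonneg _)]
    simp [dotProduct, sq]
  rw [e3]
  have := mul_le_mul_of_nonneg_left h' (Real.sqrt_nonneg (∑ i, u i ^ 2))
  have := le_abs_self (u ⬝ᵥ A *ᵥ u)
  linarith

theorem aux_exp_s16 (t : ℝ) : |Real.exp t - 1| ≤ |t| * Real.exp |t| := by
  have h1 := Real.add_one_le_exp t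
  have h2 := Real.add_one_le_exp (-t)
  have h3 : Real.exp t * Real.exp (-t) = 1 := by rw [← Real.exp_add]; simp
  have hp := Real.exp_pos t
  rcases le_total 0 t with h | h
  · rw [abs_of_nonneg h, abs_of_nonneg (by linarith)]
    nlinarith
  · rw [abs_of_nonpos h, abs_of_nonpos (by have := Real.exp_le_one_iff.2 h; linarith)]
    have : 1 ≤ Real.exp (-t) := Real.one_le_exp (by linarith)
    nlinarith

/-- **Arrival-rate estimation error bound** (core of Lemma 5 of the paper).
`I` is the Poisson Fisher information, `M` the per-period information kernel
at covariate `x`, `W = I^{−1/2}` (the unique positive semidefinite matrix with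
`W·W·I = 1`), and `‖·‖` the ℓ₂ operator norm on matrices.  An estimator close
to `θ*` in the Fisher-information norm yields an arrival-rate error controlled
by the weighted operator norm of `M`. -/
theorem stmt_16 {d : ℕ} (hd : 1 ≤ d) (Λ xbar ω : ℝ)
    (hΛ : 0 < Λ) (hxbar : 0 < xbar) (hω : 0 ≤ ω)
    (m : ℕ) (hm : 1 ≤ m) (x : ℕ → Fin d → ℝ) (xc : Fin d → ℝ)
    (hx : ∀ s ∈ Finset.range m, Real.sqrt (∑ i, x s i ^ 2) ≤ xbar)
    (hxc : Real.sqrt (∑ i, xc i ^ 2) ≤ xbar)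
    (θstar θhat : Fin d → ℝ)
    (hθstar : Real.sqrt (∑ i, θstar i ^ 2) ≤ 1)
    (δ : ℝ) (hδ : δ = Real.sqrt (∑ i, (θhat i - θstar i) ^ 2))
    (I : Matrix (Fin d) (Fin d) ℝ)
    (hI : I = ∑ s ∈ Finset.range m,
      (Λ * Real.exp (∑ i, θstar i * x s i)) • Matrix.vecMulVec (x s) (x s))
    (M : Matrix (Fin d) (Fin d) ℝ)
    (hM : M = (Λ * Real.exp (∑ i, θstar i * xc i)) • Matrix.vecMulVec xc xc)
    (hIpd : I.PosDef)
    (hquad : (θhat - θstar) ⬝ᵥ I.mulVec (θhat - θstar) ≤ ω)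
    (W : Matrix (Fin d) (Fin d) ℝ) (hWpsd : W.PosSemidef) (hW : W * W * I = 1) :
    Λ * |Real.exp (∑ i, θhat i * xc i) - Real.exp (∑ i, θstar i * xc i)| ≤
      Real.sqrt (ω * Λ * Real.exp ((2 * δ + 1) * xbar) * ‖W * M * W‖) := by
  have hx0 : 0 ≤ xbar := hxbar.le
  set v := θhat - θstar with hv
  have hδ0 : 0 ≤ δ := hδ ▸ Real.sqrt_nonneg _
  have ht : |v ⬝ᵥ xc| ≤ δ * xbar := by
    refine (aux_dot d v xc).trans ?_
    rw [hδ]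
    exact mul_le_mul_of_nonneg_left hxc (Real.sqrt_nonneg _)
  have ha : θstar ⬝ᵥ xc ≤ xbar := by
    refine (le_abs_self _).trans ((aux_dot d θstar xc).trans ?_)
    calc _ ≤ 1 * xbar := mul_le_mul hθstar hxc (Real.sqrt_nonneg _) zero_le_one
      _ = xbar := one_mul _
  have hab : (∑ i, θhat i * xc i) = θstar ⬝ᵥ xc + v ⬝ᵥ xc := by
    rw [← add_dotProduct]; simp [hv, dotProduct]
  have ha' : (∑ i, θstar i * xc i) = θstar ⬝ᵥ xc := rfl
  rw [hab, ha']
  rw [ha'] at hM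
  set a := θstar ⬝ᵥ xc
  have hWt : Wᵀ = W := by simpa [Matrix.IsHermitian] using hWpsd.1
  have hIt : Iᵀ = I := by simpa [Matrix.IsHermitian] using hIpd.1
  have hW1 : W * (W * I) = 1 := by rw [← Matrix.mul_assoc]; exact hW
  have hIWW : I * W * W = 1 := by
    rw [Matrix.mul_assoc]; exact mul_eq_one_comm.1 hW
  have key : Λ * Real.exp a * (v ⬝ᵥ xc) ^ 2 ≤ ω * ‖W * M * W‖ := by
    have q := aux_quad d (W * M * W) ((W * I) *ᵥ v)
    have e1 : ((W * I) *ᵥ v) ⬝ᵥ ((W * I) *ᵥ v) = v ⬝ᵥ I *ᵥ v := by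
      rw [dotProduct_comm, ← Matrix.vecMul_transpose (W * I) v, dotProduct_comm,
        ← Matrix.dotProduct_mulVec, Matrix.mulVec_vecMul]
      rw [Matrix.transpose_mul, hWt, hIt]
      simp only [Matrix.transpose_mul, Matrix.transpose_transpose, hWt, hIt]
      rw [← Matrix.mul_assoc, hIWW, Matrix.one_mul]
    have e2 : ((W * I) *ᵥ v) ⬝ᵥ (W * M * W) *ᵥ ((W * I) *ᵥ v)
        = Λ * Real.exp a * (v ⬝ᵥ xc) ^ 2 := by
      rw [Matrix.mulVec_mulVec, Matrix.mul_assoc (W * M), hW1, Matrix.mul_one,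
        ← Matrix.vecMul_transpose (W * I) v, ← Matrix.dotProduct_mulVec,
        Matrix.mulVec_mulVec, Matrix.transpose_mul, hWt, hIt, ← Matrix.mul_assoc, hIWW,
        Matrix.one_mul, hM, Matrix.smul_mulVec, Matrix.vecMulVec_mulVec]
      simp [dotProduct_comm xc v]
      ring_nf
      simp
    rw [e1, e2] at q
    have := mul_le_mul_of_nonneg_left hquad (norm_nonneg (W * M * W))
    linarith
  set t := v ⬝ᵥ xc
  apply Real.le_sqrt_of_sq_le
  have hd1 : |Real.exp (a + t) - Real.exp a| = Real.exp a * |Real.exp t - 1| := by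
    rw [Real.exp_add, ← abs_of_pos (Real.exp_pos a), ← abs_mul, abs_of_pos (Real.exp_pos a)]
    ring_nf
  have hd2 : |Real.exp t - 1| ^ 2 ≤ t ^ 2 * Real.exp (2 * δ * xbar) := by
    have : |Real.exp t - 1| ^ 2 ≤ (|t| * Real.exp |t|) ^ 2 :=
      pow_le_pow_left₀ (abs_nonneg _) (aux_exp_s16 t) 2
    refine this.trans ?_
    rw [mul_pow, sq_abs, ← Real.exp_nat_mul]
    refine mul_le_mul_of_nonneg_left (Real.exp_le_exp.2 ?_) (sq_nonneg _)
    push_cast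
    linarith
  have hea : Real.exp a ≤ Real.exp xbar := Real.exp_le_exp.2 ha
  have hsplit : Real.exp ((2 * δ + 1) * xbar) = Real.exp (2 * δ * xbar) * Real.exp xbar := by
    rw [← Real.exp_add]; ring_nf
  rw [hd1, hsplit]
  calc (Λ * (Real.exp a * |Real.exp t - 1|)) ^ 2
      = (Λ * Real.exp a) ^ 2 * |Real.exp t - 1| ^ 2 := by ring
    _ ≤ (Λ * Real.exp a) ^ 2 * (t ^ 2 * Real.exp (2 * δ * xbar)) := by gcongr
    _ = (Λ * Real.exp a * t ^ 2) * (Λ * Real.exp (2 * δ * xbar) * Real.exp a) := by ring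
    _ ≤ (ω * ‖W * M * W‖) * (Λ * Real.exp (2 * δ * xbar) * Real.exp xbar) := by gcongr
    _ = _ := by ring
end

section
/- Let d ≥ 1 and T ≥ 1 be integers, let V₀ be a d×d real symmetric positive definite matrix, let M₁, …, M_T be d×d real symmetric positive semidefinite matrices, set V_t = V₀ + Σ_{s=1}^t M_s, and let a > 0 and b > 0. Then Σ_{t=1}^T min{ a, b·‖V_{t−1}^{−1/2} M_t V_{t−1}^{−1/2}‖_op } ≤ (a / log(1 + a/b)) · (log(det V_T) − log(det V₀)). -/
open scoped Matrix.Norms.L2Operator BigOperators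

lemma aux_norm_det {d : ℕ} (hd : 1 ≤ d) (A : Matrix (Fin d) (Fin d) ℝ) (hA : A.PosSemidef) :
    1 + ‖A‖ ≤ (1 + A).det := by
  have hs := hA.1.spectral_theorem
  set U := hA.1.eigenvectorUnitary with hU
  set D : Matrix (Fin d) (Fin d) ℝ := Matrix.diagonal (RCLike.ofReal ∘ hA.1.eigenvalues) with hD
  have hs' : A = (U : Matrix (Fin d) (Fin d) ℝ) * D * star (U : Matrix (Fin d) (Fin d) ℝ) := by
    simpa [Unitary.conjStarAlgAut_apply] using hs
  have hnorm : ‖A‖ = ‖hA.1.eigenvalues‖ := by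
    have h1 : ‖(U : Matrix (Fin d) (Fin d) ℝ) * D * star (U : Matrix (Fin d) (Fin d) ℝ)‖ = ‖D‖ := by
      rw [← Unitary.coe_star, CStarRing.norm_mul_coe_unitary, CStarRing.norm_coe_unitary_mul]
    refine (congrArg norm hs').trans (h1.trans ?_)
    rw [hD, Matrix.l2_opNorm_diagonal]
    rfl
  have hUU : (U : Matrix (Fin d) (Fin d) ℝ) * star (U : Matrix (Fin d) (Fin d) ℝ) = 1 :=
    Unitary.mul_star_self_of_mem U.2
  have hdet : (1 + A).det = ∏ i, (1 + hA.1.eigenvalues i) := by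
    have h2 : 1 + A = (U : Matrix (Fin d) (Fin d) ℝ) * (1 + D) *
        star (U : Matrix (Fin d) (Fin d) ℝ) := by
      rw [mul_add, add_mul, mul_one, hUU, ← hs']
    have h3 : (U : Matrix (Fin d) (Fin d) ℝ).det *
        (star (U : Matrix (Fin d) (Fin d) ℝ)).det = 1 := by
      rw [← Matrix.det_mul, hUU, Matrix.det_one]
    have h4 : (1 + D).det = ∏ i, (1 + hA.1.eigenvalues i) := by
      rw [hD, ← Matrix.diagonal_one, Matrix.diagonal_add, Matrix.det_diagonal]
      rfl
    rw [h2, Matrix.det_mul, Matrix.det_mul, ← h4]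
    linear_combination (1 + D).det * h3
  rw [hdet, hnorm]
  have hnn := hA.eigenvalues_nonneg
  have key : ‖hA.1.eigenvalues‖ ≤ ∏ i, (1 + hA.1.eigenvalues i) - 1 := by
    have hle : ∀ i, 1 + hA.1.eigenvalues i ≤ ∏ i, (1 + hA.1.eigenvalues i) := by
      intro i
      rw [← Finset.mul_prod_erase _ _ (Finset.mem_univ i)]
      apply le_mul_of_one_le_right
      · linarith [hnn i]
      · exact Finset.prod_induction _ (fun y : ℝ => 1 ≤ y) (fun _ _ => one_le_mul_of_one_le_of_one_le) le_rfl
          (fun j _ => by linarith [hnn j])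
    rw [pi_norm_le_iff_of_nonneg (by linarith [hle ⟨0, hd⟩, hnn ⟨0, hd⟩])]
    intro i
    rw [Real.norm_of_nonneg (hnn i)]
    linarith [hle i]
  linarith

lemma aux_scalar (a b x : ℝ) (ha : 0 < a) (hb : 0 < b) (hx : 0 ≤ x) :
    min a (b * x) ≤ a / Real.log (1 + a / b) * Real.log (1 + x) := by
  have hc : 0 < a / b := div_pos ha hb
  have hl : 0 < Real.log (1 + a / b) := Real.log_pos (by linarith)
  rw [div_mul_eq_mul_div, le_div_iff₀ hl]
  rcases le_total (a / b) x with h | h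
  · calc _ ≤ a * Real.log (1 + a / b) := by gcongr; exact min_le_left _ _
      _ ≤ _ := by gcongr
  · have hp1 : b * x / a ≤ 1 := by
      rw [div_le_one ha]
      rw [div_eq_mul_inv] at h
      calc b * x ≤ b * (a * b⁻¹) := by gcongr
        _ = a := by field_simp
    have h1 := rpow_one_add_le_one_add_mul_self (s := a / b) (p := b * x / a)
      (by linarith) (by positivity) hp1
    have h2 : b * x / a * (a / b) = x := by field_simp
    rw [h2] at h1
    have h3 := Real.log_le_log (by positivity) h1
    rw [Real.log_rpow (by positivity)] at h3
    calc _ ≤ b * x * Real.log (1 + a / b) := by gcongr; exact min_le_right _ _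
      _ = a * (b * x / a * Real.log (1 + a / b)) := by field_simp
      _ ≤ _ := by gcongr

/-- **Truncated elliptical-potential bound** (abstract form underlying Lemmas
8 and 9 of the paper, with prefactor `a/log(1 + a/b)` playing the role of the
constants `c₆`, `c₇`).  `W t` is the inverse square root `(V t)^{−1/2}` of the
positive definite matrix `V t`, characterized as the unique positive
semidefinite matrix with `W t · W t · V t = 1`; `‖·‖` is the ℓ₂ operator
(spectral) norm on matrices. -/
theorem stmt_19 {d T : ℕ} (hd : 1 ≤ d) (hT : 1 ≤ T)
    (V₀ : Matrix (Fin d) (Fin d) ℝ) (hV₀ : V₀.PosDef)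
    (M : ℕ → Matrix (Fin d) (Fin d) ℝ) (hM : ∀ t, (M t).PosSemidef)
    (V : ℕ → Matrix (Fin d) (Fin d) ℝ)
    (hV : ∀ t, V t = V₀ + ∑ s ∈ Finset.Icc 1 t, M s)
    (W : ℕ → Matrix (Fin d) (Fin d) ℝ)
    (hWpsd : ∀ t, (W t).PosSemidef)
    (hW : ∀ t, W t * W t * V t = 1)
    (a b : ℝ) (ha : 0 < a) (hb : 0 < b) :
    ∑ t ∈ Finset.Icc 1 T, min a (b * ‖W (t - 1) * M t * W (t - 1)‖) ≤
      (a / Real.log (1 + a / b)) * (Real.log (V T).det - Real.log (V 0).det) := by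
  have hVpd : ∀ t, (V t).PosDef := fun t => by
    rw [hV t]
    exact hV₀.add_posSemidef (Matrix.posSemidef_sum _ fun i _ => hM i)
  have hstep : ∀ t, min a (b * ‖W t * M (t + 1) * W t‖) ≤
      (a / Real.log (1 + a / b)) * (Real.log (V (t + 1)).det - Real.log (V t).det) := by
    intro t
    have hA : (W t * M (t + 1) * W t).PosSemidef := by
      have := (hM (t + 1)).mul_mul_conjTranspose_same (W t)
      rwa [(hWpsd t).1.eq] at this
    have hV1 : V (t + 1) = V t + M (t + 1) := by
      rw [hV, hV t, Finset.sum_Icc_succ_top (by omega), add_assoc]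
    have hWVW : W t * V t * W t = 1 := by
      have := hW t
      rw [mul_assoc] at this
      exact mul_eq_one_comm.mp this
    have e1 : W t * V (t + 1) * W t = 1 + W t * M (t + 1) * W t := by
      rw [hV1, mul_add, add_mul, hWVW]
    have d1 := congrArg Matrix.det e1
    have d2 := congrArg Matrix.det hWVW
    simp only [Matrix.det_mul, Matrix.det_one] at d1 d2
    have d3 : (V (t + 1)).det = (V t).det * (1 + W t * M (t + 1) * W t).det := by
      rw [← d1]
      linear_combination (-(V (t + 1)).det) * d2
    have hn := aux_norm_det hd _ hA
    have hp : 0 < (1 + W t * M (t + 1) * W t).det := by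
      linarith [norm_nonneg (W t * M (t + 1) * W t)]
    rw [d3, Real.log_mul (hVpd t).det_pos.ne' hp.ne', add_sub_cancel_left]
    refine (aux_scalar a b _ ha hb (norm_nonneg _)).trans ?_
    have hl : 0 < Real.log (1 + a / b) := Real.log_pos (by linarith [div_pos ha hb])
    gcongr
  clear hT
  induction T with
  | zero => simp
  | succ n ih =>
    rw [Finset.sum_Icc_succ_top (by omega)]
    have := hstep n
    simp only [Nat.add_sub_cancel]
    linarith
end
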